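/- Assume that for prime power q and all n ≥ n₀ every Boolean degree 1 function on k-spaces of an n-dimensional F_q-vector space is trivial. Then for n ≥ n₀ there is no set P of points of PG(n-1,q) of type (α,β) with respect to (k-1)-spaces with 0 < α < β < [k]_q other than: P a single point, the points of a hyperplane, or a complement of one of these. -/

import Mathlib

open Module

/-- The total weight of the points of a subspace `S`. -/
noncomputable def subWeight {F V : Type} [Field F] [AddCommGroup V] [Module F V]
    (wt : Submodule F V → ℝ) (S : Submodule F V) : ℝ :=
  ∑ᶠ P ∈ {P : Submodule F V | finrank F P = 1 ∧ P ≤ S}, wt P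

/-- The trivial examples of Boolean degree 1 functions on `k`-spaces: `∅`, a
point-pencil, the `k`-spaces of a hyperplane, the union of a point-pencil and the
`k`-spaces of a hyperplane not containing the point, and complements of these. -/
def IsTrivialBD1 {F V : Type} [Field F] [AddCommGroup V] [Module F V] (k : ℕ)
    (Y : Set (Submodule F V)) : Prop :=
  ∃ Z : Set (Submodule F V),
    (Z = ∅ ∨
     (∃ P : Submodule F V, finrank F P = 1 ∧
        Z = {S : Submodule F V | finrank F S = k ∧ P ≤ S}) ∨
     (∃ H : Submodule F V, finrank F H = finrank F V - 1 ∧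
        Z = {S : Submodule F V | finrank F S = k ∧ S ≤ H}) ∨
     (∃ P H : Submodule F V, finrank F P = 1 ∧ finrank F H = finrank F V - 1 ∧
        ¬ P ≤ H ∧ Z = {S : Submodule F V | finrank F S = k ∧ (P ≤ S ∨ S ≤ H)})) ∧
    (Y = Z ∨ Y = {S : Submodule F V | finrank F S = k} \ Z)

open scoped Classical in
lemma subWeight_eq_sum {F V : Type} [Field F] [AddCommGroup V] [Module F V]
    [Fintype (Submodule F V)] (wt : Submodule F V → ℝ) (S : Submodule F V) :
    subWeight wt S =
      ∑ P ∈ Finset.univ.filter (fun P : Submodule F V => finrank F P = 1 ∧ P ≤ S), wt P := by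
  unfold subWeight
  rw [finsum_mem_eq_finite_toFinset_sum _ (Set.toFinite _)]
  apply Finset.sum_congr
  · ext P; simp
  · intros; rfl

lemma span_eq_iff {F V : Type} [Field F] [AddCommGroup V] [Module F V]
    (P : Submodule F V) (hP : finrank F P = 1) (v : V) (hv : v ≠ 0) :
    Submodule.span F {v} = P ↔ v ∈ P := by
  constructor
  · rintro rfl; exact Submodule.mem_span_singleton_self v
  · intro h
    have : FiniteDimensional F P := FiniteDimensional.of_finrank_pos (by omega)
    apply Submodule.eq_of_le_of_finrank_eq
    · rwa [Submodule.span_singleton_le_iff_mem]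
    · rw [finrank_span_singleton hv, hP]

open scoped Classical in
lemma subWeight_vec {F V : Type} [Field F] [Fintype F] [AddCommGroup V] [Module F V]
    [Fintype V] (wt : Submodule F V → ℝ) (S : Submodule F V) :
    ((Fintype.card F : ℝ) - 1) * subWeight wt S =
      ∑ v : V with (v ∈ S ∧ v ≠ 0), wt (Submodule.span F {v}) := by
  have : Fintype (Submodule F V) := Fintype.ofFinite _
  rw [subWeight_eq_sum, Finset.mul_sum]
  rw [← Finset.sum_fiberwise_of_maps_to (g := fun v => Submodule.span F {v})
    (t := Finset.univ.filter (fun P : Submodule F V => finrank F P = 1 ∧ P ≤ S))]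
  · apply Finset.sum_congr rfl
    intro P hP
    simp only [Finset.mem_filter, Finset.mem_univ, true_and] at hP
    rw [Finset.sum_congr rfl (g := fun _ => wt P)]
    · rw [Finset.sum_const, nsmul_eq_mul]
      congr 1
      have h1 : (Finset.univ.filter (fun v : V => v ∈ S ∧ v ≠ 0)).filter
          (fun v => Submodule.span F {v} = P) =
          (Finset.univ.filter (fun v : V => v ∈ P)).erase 0 := by
        ext v
        simp only [Finset.mem_filter, Finset.mem_univ, true_and, Finset.mem_erase]
        constructor
        · rintro ⟨⟨_, h0⟩, h⟩
          exact ⟨h0, (span_eq_iff P hP.1 v h0).1 h⟩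
        · rintro ⟨h0, h⟩
          exact ⟨⟨hP.2 h, h0⟩, (span_eq_iff P hP.1 v h0).2 h⟩
      rw [h1, Finset.card_erase_of_mem (by simp)]
      have h2 : (Finset.univ.filter (fun v : V => v ∈ P)).card = Fintype.card F := by
        rw [← Fintype.card_subtype]
        have := Module.card_eq_pow_finrank (K := F) (V := P)
        rw [hP.1, pow_one] at this
        rw [← this]
      rw [h2, Nat.cast_sub Fintype.card_pos]; simp
    · intro v hv
      simp only [Finset.mem_filter] at hv
      rw [hv.2]
  · intro v hv
    simp only [Finset.mem_filter, Finset.mem_univ, true_and] at hv ⊢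
    exact ⟨finrank_span_singleton hv.2, by rw [Submodule.span_singleton_le_iff_mem]; exact hv.1⟩

open scoped Classical in
lemma card_mem {F V : Type} [Field F] [Fintype F] [AddCommGroup V] [Module F V]
    [Fintype V] (S : Submodule F V) :
    (Finset.univ.filter (fun v : V => v ∈ S)).card = Fintype.card F ^ finrank F S := by
  rw [← Fintype.card_subtype, ← Module.card_eq_pow_finrank (K := F) (V := S)]

/-- number of points of a `k`-space -/
lemma subWeight_one {F V : Type} [Field F] [Fintype F] [AddCommGroup V] [Module F V]
    [Fintype V] (S : Submodule F V) :
    subWeight (fun _ => (1 : ℝ)) S =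
      ((∑ i ∈ Finset.range (finrank F S), Fintype.card F ^ i : ℕ) : ℝ) := by
  classical
  have hq : (1 : ℝ) < Fintype.card F := by exact_mod_cast Fintype.one_lt_card
  have h := subWeight_vec (fun _ => (1 : ℝ)) S
  have h1 : (Finset.univ.filter (fun v : V => v ∈ S ∧ v ≠ 0)) =
          (Finset.univ.filter (fun v : V => v ∈ S)).erase 0 := by
    ext v; simp [and_comm]
  rw [Finset.sum_const, h1, Finset.card_erase_of_mem (by simp), card_mem, nsmul_eq_mul, mul_one,
    Nat.cast_sub (Nat.one_le_pow _ _ Fintype.card_pos)] at h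
  push_cast at h ⊢
  rw [geom_sum_eq hq.ne', eq_div_iff (by linarith), mul_comm, h]

open scoped Classical in
lemma card_ann {F E : Type} [Field F] [Fintype F] [AddCommGroup E] [Module F E]
    [Fintype E] [Fintype (Dual F E)] (u v : E) (hu : u ≠ 0) (k : ℕ) (hE : finrank F E = k + 2) :
    (Finset.univ.filter (fun φ : Dual F E => φ u = 0 ∧ φ v = 0)).card =
      if v ∈ Submodule.span F {u} then Fintype.card F ^ (k + 1) else Fintype.card F ^ k := by
  have h1 : (Finset.univ.filter (fun φ : Dual F E => φ u = 0 ∧ φ v = 0)) =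
    Finset.univ.filter (fun φ => φ ∈ (Submodule.span F {u, v}).dualAnnihilator) := by
    ext φ
    simp only [Finset.mem_filter, Finset.mem_univ, true_and, Submodule.mem_dualAnnihilator]
    constructor
    · rintro ⟨h1, h2⟩ w hw
      rw [Submodule.mem_span_pair] at hw
      obtain ⟨a, b, rfl⟩ := hw
      simp [h1, h2]
    · intro h
      exact ⟨h u (Submodule.subset_span (by simp)), h v (Submodule.subset_span (by simp))⟩
  have h2 := Subspace.finrank_add_finrank_dualAnnihilator_eq (Submodule.span F {u, v})
  rw [h1, card_mem]
  split_ifs with hv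
  · have : Submodule.span F {u, v} = Submodule.span F {u} := by
      rw [Submodule.span_insert, sup_eq_left, Submodule.span_singleton_le_iff_mem]; exact hv
    rw [this, finrank_span_singleton hu, hE] at h2
    rw [this]; congr 1; omega
  · have : finrank F (Submodule.span F {u, v}) = 2 := by
      have hli : LinearIndependent F ![u, v] := by
        rw [LinearIndependent.pair_iff' hu]
        intro a ha
        exact hv (Submodule.mem_span_singleton.2 ⟨a, ha⟩)
      have := finrank_span_eq_card hli
      rw [Matrix.range_cons, Matrix.range_cons, Matrix.range_empty, Set.union_empty,
        Set.singleton_union, Fintype.card_fin] at this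
      exact this
    rw [this, hE] at h2
    congr 1; omega

open scoped Classical in
lemma const_lines {F E : Type} [Field F] [Fintype F] [AddCommGroup E] [Module F E]
    [Fintype E] (k : ℕ) (hE : finrank F E = k + 2) (g : E → ℝ) (c : ℝ)
    (hg : ∀ φ : Dual F E, φ ≠ 0 → ∑ v : E with φ v = 0, g v = c) :
    ∃ d : ℝ, ∀ u : E, u ≠ 0 → ∑ v : E with v ∈ Submodule.span F {u}, g v = d := by
  have : Finite (Dual F E) := Module.finite_of_finite F
  have : Fintype (Dual F E) := Fintype.ofFinite _
  have hq : 1 < Fintype.card F := Fintype.one_lt_card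
  set q : ℝ := (Fintype.card F : ℝ) with hqdef
  have hq1 : (1 : ℝ) < q := by rw [hqdef]; exact_mod_cast hq
  have hne : q ^ (k + 1) - q ^ k ≠ 0 := by
    rw [pow_succ]
    have : 0 < q ^ k := by positivity
    nlinarith
  refine ⟨((q ^ (k + 1) - 1) * c + ∑ v : E, g v - q ^ k * ∑ v : E, g v) /
    (q ^ (k + 1) - q ^ k), fun u hu => ?_⟩
  rw [eq_div_iff hne]
  have key : ∑ φ : Dual F E with φ u = 0, ∑ v : E with φ v = 0, g v =
      ∑ v : E, (if v ∈ Submodule.span F {u} then q ^ (k + 1) else q ^ k) * g v := by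
    simp_rw [Finset.sum_filter _ g]
    rw [Finset.sum_comm]
    apply Finset.sum_congr rfl
    intro v _
    rw [← Finset.sum_filter, Finset.filter_filter, Finset.sum_const, nsmul_eq_mul,
      card_ann u v hu k hE]
    split_ifs <;> simp [hqdef]
  have h1 : ∑ φ : Dual F E with φ u = 0, ∑ v : E with φ v = 0, g v =
      (q ^ (k + 1) - 1) * c + ∑ v : E, g v := by
    rw [← Finset.sum_erase_add _ _ (a := (0 : Dual F E)) (by simp)]
    congr 1
    · rw [Finset.sum_congr rfl (g := fun _ => c), Finset.sum_const, nsmul_eq_mul,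
        Finset.card_erase_of_mem (by simp)]
      · have := card_ann u u hu k hE
        simp only [and_self, Submodule.mem_span_singleton_self, if_true] at this
        rw [this, Nat.cast_sub (Nat.one_le_pow _ _ (by omega))]
        simp [hqdef]
      · intro φ hφ
        exact hg φ (Finset.ne_of_mem_erase hφ)
    · simp
  rw [← h1, key, Finset.sum_filter, Finset.sum_mul, Finset.mul_sum, ← Finset.sum_sub_distrib]
  apply Finset.sum_congr rfl
  intro v _
  split_ifs <;> ring

open scoped Classical in
lemma sum_map {F V : Type} [Field F] [Fintype F] [AddCommGroup V] [Module F V]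
    [Fintype V] (wt : Submodule F V → ℝ) (W : Submodule F V) (T : Submodule F W) :
    ∑ v : W with v ∈ T, (if v = 0 then 0 else wt (Submodule.span F {(v : V)})) =
      ((Fintype.card F : ℝ) - 1) * subWeight wt (T.map W.subtype) := by
  rw [subWeight_vec]
  have h0 : ∑ v : W with v ∈ T, (if v = 0 then 0 else wt (Submodule.span F {(v : V)})) =
      ∑ v : W with (v ∈ T ∧ v ≠ 0), wt (Submodule.span F {(v : V)}) := by
    rw [← Finset.filter_filter, Finset.sum_filter _ (fun v : W => wt (Submodule.span F {(v : V)}))]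
    apply Finset.sum_congr rfl
    intro v _
    by_cases h : v = 0 <;> simp [h]
  rw [h0]
  apply Finset.sum_bij (fun (v : W) _ => (v : V))
  · intro v hv
    simp only [Finset.mem_filter, Finset.mem_univ, true_and] at hv ⊢
    exact ⟨⟨v, hv.1, rfl⟩, by simpa using hv.2⟩
  · intro v _ w _ h
    exact Subtype.ext h
  · intro x hx
    simp only [Finset.mem_filter, Finset.mem_univ, true_and] at hx
    obtain ⟨⟨v, hv, rfl⟩, hx0⟩ := hx
    refine ⟨v, ?_, rfl⟩
    simp only [Finset.mem_filter, Finset.mem_univ, true_and]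
    refine ⟨hv, ?_⟩
    rintro rfl
    simp at hx0
  · intros; rfl

lemma subWeight_congr {F V : Type} [Field F] [AddCommGroup V] [Module F V]
    (wt wt' : Submodule F V → ℝ) (S : Submodule F V)
    (h : ∀ P : Submodule F V, finrank F P = 1 → P ≤ S → wt P = wt' P) :
    subWeight wt S = subWeight wt' S := by
  unfold subWeight
  exact finsum_mem_congr rfl (fun P hP => h P hP.1 hP.2)

lemma subWeight_lin {F V : Type} [Field F] [AddCommGroup V] [Module F V]
    [Finite V] (wt wt' : Submodule F V → ℝ) (a b : ℝ) (S : Submodule F V) :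
    subWeight (fun P => a * wt P + b * wt' P) S = a * subWeight wt S + b * subWeight wt' S := by
  classical
  have : Fintype (Submodule F V) := Fintype.ofFinite _
  simp only [subWeight_eq_sum, Finset.sum_add_distrib, Finset.mul_sum]

lemma subWeight_point {F V : Type} [Field F] [AddCommGroup V] [Module F V]
    (wt : Submodule F V → ℝ) (P : Submodule F V) (hP : finrank F P = 1) :
    subWeight wt P = wt P := by
  unfold subWeight
  have : {Q : Submodule F V | finrank F Q = 1 ∧ Q ≤ P} = {P} := by
    ext Q
    simp only [Set.mem_ofPred_eq, Set.mem_singleton_iff]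
    constructor
    · rintro ⟨h1, h2⟩
      have : FiniteDimensional F P := FiniteDimensional.of_finrank_pos (by omega)
      exact Submodule.eq_of_le_of_finrank_eq h2 (by omega)
    · rintro rfl; exact ⟨hP, le_rfl⟩
  rw [this, finsum_mem_singleton]

lemma exists_sub {F V : Type} [Field F] [AddCommGroup V] [Module F V]
    (W : Submodule F V) (m : ℕ) (hm : m ≤ finrank F W) :
    ∃ U : Submodule F V, U ≤ W ∧ finrank F U = m := by
  obtain ⟨f, hf⟩ := exists_linearIndependent_of_le_finrank hm
  refine ⟨(Submodule.span F (Set.range f)).map W.subtype, Submodule.map_subtype_le _ _, ?_⟩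
  rw [Submodule.finrank_map_subtype_eq]
  simpa using finrank_span_eq_card hf

lemma const_W {F V : Type} [Field F] [Fintype F] [AddCommGroup V] [Module F V]
    [Fintype V] (k : ℕ) (wt : Submodule F V → ℝ) (W : Submodule F V)
    (hW : finrank F W = k + 2) (c : ℝ)
    (h : ∀ S : Submodule F V, S ≤ W → finrank F S = k + 1 → subWeight wt S = c) :
    ∃ d : ℝ, (∀ P : Submodule F V, P ≤ W → finrank F P = 1 → wt P = d) ∧
      c = d * ((∑ i ∈ Finset.range (k + 1), Fintype.card F ^ i : ℕ) : ℝ) := by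
  classical
  have hq1 : (1 : ℝ) < Fintype.card F := by exact_mod_cast Fintype.one_lt_card
  obtain ⟨d, hd⟩ := const_lines (F := F) k hW
    (fun v : W => if v = 0 then 0 else wt (Submodule.span F {(v : V)}))
    (((Fintype.card F : ℝ) - 1) * c) (by
      intro φ hφ
      have h1 := sum_map wt W (LinearMap.ker φ)
      simp only [LinearMap.mem_ker] at h1
      rw [h1, h _ (Submodule.map_subtype_le _ _)]
      rw [Submodule.finrank_map_subtype_eq]
      have := Module.Dual.finrank_ker_add_one_of_ne_zero hφ
      omega)
  have hP : ∀ P : Submodule F V, P ≤ W → finrank F P = 1 →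
      wt P = d / ((Fintype.card F : ℝ) - 1) := by
    intro P hPW hP
    obtain ⟨p, hp0, hp⟩ := finrank_eq_one_iff'.1 hP
    have hp0' : (p : V) ≠ 0 := by simpa using hp0
    have hsp : Submodule.span F {(p : V)} = P := (span_eq_iff P hP _ hp0').2 p.2
    have h1 := hd ⟨p, hPW p.2⟩ (by simpa using hp0)
    rw [sum_map, Submodule.map_span, Set.image_singleton, Submodule.subtype_apply, hsp,
      subWeight_point _ _ hP] at h1
    rw [eq_div_iff (by linarith), mul_comm, h1]
  refine ⟨_, hP, ?_⟩
  obtain ⟨S, hSW, hS⟩ := exists_sub W (k + 1) (by omega)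
  rw [← h S hSW hS, subWeight_congr wt (fun P => (d / ((Fintype.card F : ℝ) - 1)) *
    (fun _ => (1 : ℝ)) P + 0 * (fun _ => (1 : ℝ)) P) S, subWeight_lin, subWeight_one, hS]
  · ring
  · intro P h1 h2
    rw [hP P (h2.trans hSW) h1]; simp

lemma card_eq_subWeight {F V : Type} [Field F] [AddCommGroup V] [Module F V]
    [Finite V] (B : Set (Submodule F V)) (S : Submodule F V) :
    (Nat.card {P : Submodule F V // finrank F P = 1 ∧ P ≤ S ∧ P ∈ B} : ℝ) =
      subWeight (B.indicator 1) S := by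
  classical
  have : Fintype (Submodule F V) := Fintype.ofFinite _
  rw [subWeight_eq_sum, Nat.card_eq_fintype_card, Fintype.card_subtype]
  simp only [Set.indicator_apply, Pi.one_apply]
  rw [← Finset.sum_filter, Finset.filter_filter, Finset.sum_const]
  simp [and_assoc]

/-- If `W` is a `k+1`-space all of whose `k`-spaces meet `B` in `γ` points, then `γ` is extreme. -/
lemma extreme {F V : Type} [Field F] [Fintype F] [AddCommGroup V] [Module F V]
    [Fintype V] (k : ℕ) (hk : 1 ≤ k) (B : Set (Submodule F V)) (W : Submodule F V)
    (hW : finrank F W = k + 1) (γ : ℕ)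
    (h : ∀ S : Submodule F V, S ≤ W → finrank F S = k →
      Nat.card {P : Submodule F V // finrank F P = 1 ∧ P ≤ S ∧ P ∈ B} = γ)
    (h0 : 0 < γ) (h1 : γ < ∑ i ∈ Finset.range k, Fintype.card F ^ i) : False := by
  classical
  obtain ⟨k, rfl⟩ : ∃ m, k = m + 1 := ⟨k - 1, by omega⟩
  obtain ⟨d, hd, hc⟩ := const_W k (B.indicator 1) W hW γ (by
    intro S hS hSk
    rw [← card_eq_subWeight, h S hS hSk])
  obtain ⟨P, hPW, hP⟩ := exists_sub W 1 (by omega)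
  have := hd P hPW hP
  rw [Set.indicator_apply] at this
  split_ifs at this
  · rw [← this, Pi.one_apply, one_mul] at hc
    have := Nat.cast_injective hc
    omega
  · rw [← this, zero_mul] at hc
    have : γ = 0 := by exact_mod_cast hc
    omega

/-- A trivial family is constant on the `k`-subspaces of a suitable `k+1`-space. -/
lemma trivial_const {F V : Type} [Field F] [AddCommGroup V] [Module F V]
    (k : ℕ) (hk : k + 2 ≤ finrank F V) (Y : Set (Submodule F V)) (hY : IsTrivialBD1 k Y) :
    ∃ W : Submodule F V, finrank F W = k + 1 ∧
      ((∀ S, S ≤ W → finrank F S = k → S ∈ Y) ∨ (∀ S, S ≤ W → finrank F S = k → S ∉ Y)) := by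
  have : FiniteDimensional F V := FiniteDimensional.of_finrank_pos (by omega)
  obtain ⟨Z, hZ, hYZ⟩ := hY
  have main : ∃ W : Submodule F V, finrank F W = k + 1 ∧
      ((∀ S, S ≤ W → finrank F S = k → S ∈ Z) ∨ (∀ S, S ≤ W → finrank F S = k → S ∉ Z)) := by
    rcases hZ with rfl | ⟨P, hP, rfl⟩ | ⟨H, hH, rfl⟩ | ⟨P, H, hP, hH, hPH, rfl⟩
    · obtain ⟨W, -, hW⟩ := exists_sub (⊤ : Submodule F V) (k + 1) (by rw [finrank_top]; omega)
      exact ⟨W, hW, Or.inr (by simp)⟩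
    · obtain ⟨Q, hQ⟩ := Submodule.exists_isCompl P
      have := Submodule.finrank_add_eq_of_isCompl hQ
      obtain ⟨W, hWQ, hW⟩ := exists_sub Q (k + 1) (by omega)
      refine ⟨W, hW, Or.inr ?_⟩
      rintro S hS - ⟨-, hPS⟩
      have hb : P ≤ ⊥ := hQ.disjoint le_rfl (hPS.trans (hS.trans hWQ))
      rw [le_bot_iff] at hb
      rw [hb, finrank_bot] at hP
      omega
    · obtain ⟨W, hWH, hW⟩ := exists_sub H (k + 1) (by omega)
      exact ⟨W, hW, Or.inl fun S hS hSk => ⟨hSk, hS.trans hWH⟩⟩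
    · obtain ⟨W, hWH, hW⟩ := exists_sub H (k + 1) (by omega)
      exact ⟨W, hW, Or.inl fun S hS hSk => ⟨hSk, Or.inr (hS.trans hWH)⟩⟩
  obtain ⟨W, hW, h⟩ := main
  refine ⟨W, hW, ?_⟩
  rcases hYZ with rfl | rfl
  · exact h
  · rcases h with h | h
    · exact Or.inr fun S h1 h2 h3 => h3.2 (h S h1 h2)
    · exact Or.inl fun S h1 h2 => ⟨h2, h S h1 h2⟩

lemma main_case {F V : Type} [Field F] [Fintype F] [AddCommGroup V] [Module F V]
    (k : ℕ) (hk : 2 ≤ k) (hn : k + 2 ≤ finrank F V)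
    (htriv : ∀ wt : Submodule F V → ℝ,
        (∀ S : Submodule F V, finrank F S = k →
          subWeight wt S = 0 ∨ subWeight wt S = 1) →
        IsTrivialBD1 k {S : Submodule F V | finrank F S = k ∧ subWeight wt S = 1})
    (B : Set (Submodule F V)) (α β : ℕ) (h0 : 0 < α) (hab : α < β)
    (hb : β < ∑ i ∈ Finset.range k, Fintype.card F ^ i)
    (hB : ∀ S : Submodule F V, finrank F S = k →
          Nat.card {P : Submodule F V // finrank F P = 1 ∧ P ≤ S ∧ P ∈ B} = α ∨
          Nat.card {P : Submodule F V // finrank F P = 1 ∧ P ≤ S ∧ P ∈ B} = β) : False := by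
  classical
  have : FiniteDimensional F V := FiniteDimensional.of_finrank_pos (by omega)
  have : Finite V := Module.finite_of_finite F
  have : Fintype V := Fintype.ofFinite V
  set N : ℕ := ∑ i ∈ Finset.range k, Fintype.card F ^ i with hN
  have hNpos : (N : ℝ) ≠ 0 := by
    have : N ≠ 0 := by omega
    exact_mod_cast this
  have hba : (β : ℝ) - α ≠ 0 := by
    have : (α : ℝ) < β := by exact_mod_cast hab
    linarith
  have hw : ∀ S : Submodule F V, finrank F S = k →
      subWeight (fun P => (1 / ((β : ℝ) - α)) * B.indicator 1 P +
        (-(α / N) / ((β : ℝ) - α)) * (fun _ => (1 : ℝ)) P) S =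
      ((Nat.card {P : Submodule F V // finrank F P = 1 ∧ P ≤ S ∧ P ∈ B} : ℝ) - α) / (β - α) := by
    intro S hS
    rw [subWeight_lin, subWeight_one, hS, ← card_eq_subWeight, ← hN]
    field_simp
    ring
  have ht := htriv _ (by
    intro S hS
    rw [hw S hS]
    rcases hB S hS with h | h
    · left; rw [h]; simp
    · right; rw [h]; exact div_self hba)
  obtain ⟨W, hW, h⟩ := trivial_const k hn _ ht
  rcases h with h | h
  · refine extreme k (by omega) B W hW β ?_ (by omega) (by omega)
    intro S hS hSk
    have h1 := (h S hS hSk).2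
    rw [hw S hSk] at h1
    rcases hB S hSk with h2 | h2
    · rw [h2] at h1; simp at h1
    · exact h2
  · refine extreme k (by omega) B W hW α ?_ (by omega) (by omega)
    intro S hS hSk
    have h1 := h S hS hSk
    rcases hB S hSk with h2 | h2
    · exact h2
    · exfalso
      apply h1
      refine ⟨hSk, ?_⟩
      rw [hw S hSk, h2]
      exact div_self hba

lemma hyper_wt {F V : Type} [Field F] [Fintype F] [AddCommGroup V] [Module F V]
    [Fintype V] (k : ℕ) (hV : finrank F V = k + 2) (H : Submodule F V)
    (hH : finrank F H = k + 1) :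
    ∃ wt : Submodule F V → ℝ, ∀ S : Submodule F V, finrank F S = k + 1 →
      (S = H → subWeight wt S = 1) ∧ (S ≠ H → subWeight wt S = 0) := by
  classical
  set N : ℕ → ℕ := fun m => ∑ i ∈ Finset.range m, Fintype.card F ^ i with hN
  have hq : (0 : ℝ) < Fintype.card F := by exact_mod_cast Fintype.card_pos
  have hNs : (N (k + 1) : ℝ) = N k + (Fintype.card F : ℝ) ^ k := by
    simp only [hN, Finset.sum_range_succ]; push_cast; ring
  have hqk : (0 : ℝ) < (Fintype.card F : ℝ) ^ k := by positivity
  have hNk : (0 : ℝ) ≤ N k := Nat.cast_nonneg _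
  have hNk1 : (N (k + 1) : ℝ) ≠ 0 := by rw [hNs]; positivity
  have hind : ∀ S : Submodule F V,
      subWeight ({P | P ≤ H}.indicator 1) S = (N (finrank F (S ⊓ H : Submodule F V)) : ℝ) := by
    intro S
    rw [hN, ← subWeight_one]
    have : Fintype (Submodule F V) := Fintype.ofFinite _
    rw [subWeight_eq_sum, subWeight_eq_sum]
    simp only [Set.indicator_apply, Pi.one_apply]
    rw [← Finset.sum_filter, Finset.filter_filter]
    apply Finset.sum_congr
    · ext P; simp [and_assoc]
    · intros; rfl
  refine ⟨fun P => (-(N k / N (k + 1)) / (Fintype.card F : ℝ) ^ k) * (fun _ => (1 : ℝ)) P +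
    (1 / (Fintype.card F : ℝ) ^ k) * ({P | P ≤ H}.indicator 1 : Submodule F V → ℝ) P, ?_⟩
  intro S hS
  rw [subWeight_lin, subWeight_one, hS, hind]
  change (S = H → _ * (N (k + 1) : ℝ) + _ = _) ∧ (S ≠ H → _ * (N (k + 1) : ℝ) + _ = _)
  constructor
  · rintro rfl
    rw [inf_idem, hS]
    have : (-(N k / N (k + 1)) / (Fintype.card F : ℝ) ^ k) * (N (k + 1) : ℝ) =
      - N k / (Fintype.card F : ℝ) ^ k := by field_simp
    rw [this, hNs]
    field_simp
    ring
  · intro hne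
    have hd : finrank F (S ⊓ H : Submodule F V) = k := by
      have h1 := Submodule.finrank_sup_add_finrank_inf_eq S H
      have h2 : finrank F (S ⊔ H : Submodule F V) ≤ k + 2 := hV ▸ Submodule.finrank_le _
      have h3 : finrank F (S ⊓ H : Submodule F V) < k + 1 := by
        rw [← hS]
        apply Submodule.finrank_lt_finrank_of_lt
        refine lt_of_le_of_ne inf_le_left fun h => hne ?_
        exact Submodule.eq_of_le_of_finrank_eq (inf_eq_left.1 h) (by omega)
      omega
    rw [hd]
    field_simp
    ring

/-- The hyperplane with equation `a x + b y + c z = 0`. -/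
def hypK {F : Type} [Field F] (m : ℕ) (a b c : F) : Submodule F (F × F × F × (Fin m → F)) where
  carrier := {v | a * v.1 + b * v.2.1 + c * v.2.2.1 = 0}
  add_mem' := by
    intro v w hv hw
    simp only [Set.mem_ofPred_eq, Prod.fst_add, Prod.snd_add] at *
    linear_combination hv + hw
  zero_mem' := by simp
  smul_mem' := by
    intro r v hv
    simp only [Set.mem_ofPred_eq, Prod.smul_fst, Prod.smul_snd, smul_eq_mul] at *
    linear_combination r * hv

lemma mem_hypK {F : Type} [Field F] {m : ℕ} {a b c : F} {v : F × F × F × (Fin m → F)} :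
    v ∈ hypK m a b c ↔ a * v.1 + b * v.2.1 + c * v.2.2.1 = 0 := Iff.rfl

lemma hypK_eq {F : Type} [Field F] {m : ℕ} {a b c a' b' c' : F}
    (h : hypK m a b c = hypK m a' b' c') :
    a * b' = a' * b ∧ b * c' = b' * c ∧ a * c' = a' * c := by
  have h1 : ((b, -a, 0, 0) : F × F × F × (Fin m → F)) ∈ hypK m a b c := by
    rw [mem_hypK]; ring
  have h2 : ((0, c, -b, 0) : F × F × F × (Fin m → F)) ∈ hypK m a b c := by
    rw [mem_hypK]; ring
  have h3 : ((c, 0, -a, 0) : F × F × F × (Fin m → F)) ∈ hypK m a b c := by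
    rw [mem_hypK]; ring
  rw [h, mem_hypK] at h1 h2 h3
  simp only at h1 h2 h3
  refine ⟨?_, ?_, ?_⟩
  · linear_combination -h1
  · linear_combination -h2
  · linear_combination -h3

lemma finrank_hypK {F : Type} [Field F] (m : ℕ) (a b c : F) (h : a ≠ 0 ∨ b ≠ 0 ∨ c ≠ 0) :
    finrank F (hypK m a b c) = m + 2 := by
  let φ : Dual F (F × F × F × (Fin m → F)) :=
    { toFun := fun v => a * v.1 + b * v.2.1 + c * v.2.2.1
      map_add' := by intro v w; simp only [Prod.fst_add, Prod.snd_add]; ring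
      map_smul' := by
        intro r v
        simp only [Prod.smul_fst, Prod.smul_snd, smul_eq_mul, RingHom.id_apply]; ring }
  have hK : hypK m a b c = LinearMap.ker φ := by
    ext v; rfl
  have hφ : φ ≠ 0 := by
    intro h0
    have e1 : φ (1, 0, 0, 0) = 0 := by rw [h0]; rfl
    have e2 : φ (0, 1, 0, 0) = 0 := by rw [h0]; rfl
    have e3 : φ (0, 0, 1, 0) = 0 := by rw [h0]; rfl
    simp [φ] at e1 e2 e3
    simp_all
  have := Module.Dual.finrank_ker_add_one_of_ne_zero hφ
  rw [hK]
  simp at this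
  omega

lemma small_case {F : Type} [Field F] [Fintype F] (m : ℕ)
    (htriv : ∀ wt : Submodule F (F × F × F × (Fin m → F)) → ℝ,
        (∀ S : Submodule F (F × F × F × (Fin m → F)), finrank F S = m + 2 →
          subWeight wt S = 0 ∨ subWeight wt S = 1) →
        IsTrivialBD1 (m + 2) {S : Submodule F (F × F × F × (Fin m → F)) |
          finrank F S = m + 2 ∧ subWeight wt S = 1}) : False := by
  classical
  have hV : finrank F (F × F × F × (Fin m → F)) = m + 3 := by simp; omega
  have hfr : ∀ a b c : F, (a ≠ 0 ∨ b ≠ 0 ∨ c ≠ 0) → finrank F (hypK m a b c) = m + 2 :=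
    fun a b c h => finrank_hypK m a b c h
  have hne : hypK m (1 : F) 0 0 ≠ hypK m 0 1 0 := by
    intro h; have := hypK_eq h; simp at this
  obtain ⟨w1, hw1⟩ := hyper_wt (m + 1) hV (hypK m (1 : F) 0 0) (hfr _ _ _ (by simp))
  obtain ⟨w2, hw2⟩ := hyper_wt (m + 1) hV (hypK m (0 : F) 1 0) (hfr _ _ _ (by simp))
  have hval : ∀ S : Submodule F (F × F × F × (Fin m → F)), finrank F S = m + 2 →
      subWeight (fun P => 1 * w1 P + 1 * w2 P) S =
        if S = hypK m (1 : F) 0 0 ∨ S = hypK m (0 : F) 1 0 then 1 else 0 := by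
    intro S hS
    rw [subWeight_lin]
    by_cases h1 : S = hypK m (1 : F) 0 0
    · rw [(hw1 S hS).1 h1, (hw2 S hS).2 (by rw [h1]; exact hne)]
      simp [h1]
    · by_cases h2 : S = hypK m (0 : F) 1 0
      · rw [(hw1 S hS).2 h1, (hw2 S hS).1 h2]
        simp [h2]
      · rw [(hw1 S hS).2 h1, (hw2 S hS).2 h2]
        simp [h1, h2]
  have ht := htriv (fun P => 1 * w1 P + 1 * w2 P) (by
    intro S hS
    rw [hval S hS]
    split_ifs <;> simp)
  have hY : {S : Submodule F (F × F × F × (Fin m → F)) |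
          finrank F S = m + 2 ∧ subWeight (fun P => 1 * w1 P + 1 * w2 P) S = 1} =
          {hypK m (1 : F) 0 0, hypK m (0 : F) 1 0} := by
    ext S
    simp only [Set.mem_ofPred_eq, Set.mem_insert_iff, Set.mem_singleton_iff]
    constructor
    · rintro ⟨h1, h2⟩
      rw [hval S h1] at h2
      by_contra h3
      rw [if_neg h3] at h2
      exact zero_ne_one h2
    · intro h
      have hS : finrank F S = m + 2 := by
        rcases h with rfl | rfl <;> exact hfr _ _ _ (by simp)
      exact ⟨hS, by rw [hval S hS, if_pos h]⟩
  rw [hY] at ht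
  have hi : ∀ a b c : F, hypK m a b c ∈
      ({hypK m (1 : F) 0 0, hypK m (0 : F) 1 0} : Set (Submodule F (F × F × F × (Fin m → F)))) →
      c = 0 ∧ (a = 0 ∨ b = 0) := by
    intro a b c h
    rcases h with h | h
    · have := hypK_eq h; simp at this; tauto
    · have := hypK_eq h; simp at this; tauto
  have hm1 : hypK m (1 : F) 0 0 ∈ ({hypK m (1 : F) 0 0, hypK m (0 : F) 1 0} :
    Set (Submodule F (F × F × F × (Fin m → F)))) := by simp
  have hm2 : hypK m (0 : F) 1 0 ∈ ({hypK m (1 : F) 0 0, hypK m (0 : F) 1 0} :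
    Set (Submodule F (F × F × F × (Fin m → F)))) := by simp
  generalize ({hypK m (1 : F) 0 0, hypK m (0 : F) 1 0} :
    Set (Submodule F (F × F × F × (Fin m → F)))) = Y at ht hi hm1 hm2
  -- points
  have hpt : ∀ P : Submodule F (F × F × F × (Fin m → F)), finrank F P = 1 →
      ∃ x y z : F, ∀ a b c : F, P ≤ hypK m a b c ↔ a * x + b * y + c * z = 0 := by
    intro P hP
    obtain ⟨p, hp0, hp⟩ := finrank_eq_one_iff'.1 hP
    have hp0' : (p : F × F × F × (Fin m → F)) ≠ 0 := by simpa using hp0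
    have hsp := (span_eq_iff P hP _ hp0').2 p.2
    refine ⟨p.1.1, p.1.2.1, p.1.2.2.1, fun a b c => ?_⟩
    have h1 := Submodule.span_singleton_le_iff_mem (p : F × F × F × (Fin m → F)) (hypK m a b c)
    rw [hsp] at h1
    exact h1
  -- a hyperplane through a given point and not in `Y`
  have hthr : ∀ x y z : F, ∃ a b c : F, (a ≠ 0 ∨ b ≠ 0 ∨ c ≠ 0) ∧
      a * x + b * y + c * z = 0 ∧ hypK m a b c ∉ Y := by
    intro x y z
    by_cases hx : x = 0
    · by_cases hy : y = 0
      · refine ⟨1, 1, 0, by simp, by simp [hx, hy], fun h => ?_⟩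
        simpa using (hi _ _ _ h).2
      · refine ⟨0, -z / y, 1, by simp, by field_simp; simp, fun h => ?_⟩
        simpa using (hi _ _ _ h).1
    · refine ⟨-z / x, 0, 1, by simp, by field_simp; simp, fun h => ?_⟩
      simpa using (hi _ _ _ h).1
  have hn3 : ∀ a b : F, hypK m a b 1 ∉ Y := fun a b h => by simpa using (hi _ _ _ h).1
  have hf3 : ∀ a b : F, finrank F (hypK m a b 1) = m + 2 := fun a b => hfr _ _ _ (by simp)
  obtain ⟨Z, hZ, hYZ⟩ := ht
  rcases hZ with rfl | ⟨P, hP, rfl⟩ | ⟨H, hH, rfl⟩ | ⟨P, H, hP, hH, hPH, rfl⟩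
  · rcases hYZ with rfl | rfl
    · exact hm1
    · exact hn3 0 0 ⟨hf3 0 0, by simp⟩
  · obtain ⟨x, y, z, hxyz⟩ := hpt P hP
    rcases hYZ with rfl | rfl
    · obtain ⟨a, b, c, h1, h2, h3⟩ := hthr x y z
      exact h3 ⟨hfr _ _ _ h1, (hxyz _ _ _).2 h2⟩
    · have hh : ∀ a b : F, a * x + b * y + 1 * z = 0 := by
        intro a b
        by_contra hc
        exact hn3 a b ⟨hf3 a b, fun h => hc ((hxyz _ _ _).1 h.2)⟩
      refine hm1.2 ⟨hm1.1, (hxyz _ _ _).2 ?_⟩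
      linear_combination hh 1 0 - hh 0 0
  · rw [hV] at hH
    have hle : ∀ S : Submodule F (F × F × F × (Fin m → F)), finrank F S = m + 2 → S ≤ H → S = H :=
      fun S hS h => Submodule.eq_of_le_of_finrank_eq h (by omega)
    rcases hYZ with rfl | rfl
    · exact hne ((hle _ hm1.1 hm1.2).trans (hle _ hm2.1 hm2.2).symm)
    · have hh : ∀ a b : F, hypK m a b 1 = H := by
        intro a b
        by_contra hc
        exact hn3 a b ⟨hf3 a b, fun h => hc (hle _ (hf3 a b) h.2)⟩
      have := hypK_eq ((hh 0 0).trans (hh 1 0).symm)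
      simp at this
  · rw [hV] at hH
    have hle : ∀ S : Submodule F (F × F × F × (Fin m → F)), finrank F S = m + 2 → S ≤ H → S = H :=
      fun S hS h => Submodule.eq_of_le_of_finrank_eq h (by omega)
    obtain ⟨x, y, z, hxyz⟩ := hpt P hP
    rcases hYZ with rfl | rfl
    · obtain ⟨a, b, c, h1, h2, h3⟩ := hthr x y z
      exact h3 ⟨hfr _ _ _ h1, Or.inl ((hxyz _ _ _).2 h2)⟩
    · have hx : x ≠ 0 := fun h => hm1.2 ⟨hm1.1, Or.inl ((hxyz _ _ _).2 (by simp [h]))⟩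
      have hy : y ≠ 0 := fun h => hm2.2 ⟨hm2.1, Or.inl ((hxyz _ _ _).2 (by simp [h]))⟩
      have hh : ∀ a b : F, a * x + b * y + 1 * z ≠ 0 → hypK m a b 1 = H := by
        intro a b hc
        by_contra hc'
        refine hn3 a b ⟨hf3 a b, ?_⟩
        rintro ⟨-, h | h⟩
        · exact hc ((hxyz _ _ _).1 h)
        · exact hc' (hle _ (hf3 a b) h)
      have huniq : ∀ a b a' b' : F, a * x + b * y + 1 * z ≠ 0 → a' * x + b' * y + 1 * z ≠ 0 →
          a = a' ∧ b = b' := by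
        intro a b a' b' h1 h2
        have := hypK_eq ((hh a b h1).trans (hh a' b' h2).symm)
        simp only [mul_one] at this
        exact ⟨this.2.2, this.2.1⟩
      by_cases hz : z = 0
      · have := huniq 1 0 0 1 (by simpa [hz] using hx) (by simpa [hz] using hy)
        simp at this
      · by_cases h1 : x + z = 0
        · have := huniq 0 0 1 1 (by simpa using hz) (by
            intro h; apply hy; linear_combination h - h1)
          simp at this
        · have := huniq 0 0 1 0 (by simpa using hz) (by simpa using h1)
          simp at this

/-- If for all `n ≥ n₀` every Boolean degree 1 function on `k`-spaces of an
`n`-dimensional `F_q`-space is trivial, then for `n ≥ n₀` every set of points of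
type `(α,β)` with respect to `k`-spaces with `0 < α < β < [k]_q` is a point, the
points of a hyperplane, or a complement of one of these. -/
theorem stmt_16 (q k n₀ : ℕ) (hq : IsPrimePow q) (hk : 2 ≤ k)
    (htriv : ∀ (F V : Type) [Field F] [Fintype F] [AddCommGroup V] [Module F V],
      Fintype.card F = q → n₀ ≤ finrank F V →
      ∀ wt : Submodule F V → ℝ,
        (∀ S : Submodule F V, finrank F S = k →
          subWeight wt S = 0 ∨ subWeight wt S = 1) →
        IsTrivialBD1 k {S : Submodule F V | finrank F S = k ∧ subWeight wt S = 1}) :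
    ∀ (F V : Type) [Field F] [Fintype F] [AddCommGroup V] [Module F V],
      Fintype.card F = q → n₀ ≤ finrank F V →
      ∀ (B : Set (Submodule F V)) (α β : ℕ),
        B ⊆ {P | finrank F P = 1} →
        0 < α → α < β → β < ∑ i ∈ Finset.range k, q ^ i →
        (∀ S : Submodule F V, finrank F S = k →
          Nat.card {P : Submodule F V // finrank F P = 1 ∧ P ≤ S ∧ P ∈ B} = α ∨
          Nat.card {P : Submodule F V // finrank F P = 1 ∧ P ≤ S ∧ P ∈ B} = β) →
        ∃ Z : Set (Submodule F V),
          ((∃ P : Submodule F V, finrank F P = 1 ∧ Z = {P}) ∨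
           (∃ H : Submodule F V, finrank F H = finrank F V - 1 ∧
              Z = {P : Submodule F V | finrank F P = 1 ∧ P ≤ H})) ∧
          (B = Z ∨ B = {P : Submodule F V | finrank F P = 1} \ Z) := by

  intro F V _ _ _ _ hF hV B α β hB h0 hab hb hcard
  exfalso
  by_cases hn : n₀ ≤ k + 1
  · obtain ⟨m, rfl⟩ : ∃ m, k = m + 2 := ⟨k - 2, by omega⟩
    apply small_case (F := F) m
    exact htriv F (F × F × F × (Fin m → F)) hF (by simp; omega)
  · subst hF
    exact main_case k hk (by omega) (htriv F V rfl hV) B α β h0 hab hb hcard
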